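/- With A the (2N+8) × (2N+8) Biot-DA propagation matrix as above, assume χ > 0, μ > 0, ρ_w > 0, B := (λ_f + 2μ)ρ_w + m(ρ − 2ρ_f β) > 0, C := m(λ₀ + 2μ) > 0 and B² − 4χC ≥ 0. Then all eigenvalues of A are real; they are 0 (with multiplicity 2N+2), ±√(μρ_w/χ), and ±c_{pf}, ±c_{ps}, where c_{pf}² ≥ c_{ps}² > 0 are the two roots of the quadratic χ X² − B X + C = 0. In particular the system ∂U/∂t + A ∂U/∂x + B ∂U/∂y = −SU is hyperbolic in the x-direction. -/

import Mathlib

open Polynomial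

/-- Entry `(i, j)` of the Biot-DA propagation matrix `A` along `x` (indices in `ℕ`):
block structure `[[0₄, A₁, 0], [A₂, 0₄, 0], [0, A₃, 0]]`. -/
noncomputable def biotAEntry (lamf μ m β ρ ρf ρw χ : ℝ) : ℕ → ℕ → ℝ
  | 0, 4 => -ρw / χ
  | 0, 7 => -ρf / χ
  | 1, 5 => -ρw / χ
  | 2, 4 => ρf / χ
  | 2, 7 => ρ / χ
  | 3, 5 => ρf / χ
  | 4, 0 => -(lamf + 2 * μ)
  | 4, 2 => -(m * β)
  | 5, 1 => -μ
  | 6, 0 => -lamf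
  | 6, 2 => -(m * β)
  | 7, 0 => m * β
  | 7, 2 => m
  | i, j =>
      if 8 ≤ i then
        if (i - 8) % 2 = 0 then
          (if j = 4 then ρf / χ else if j = 7 then ρ / χ else 0)
        else
          (if j = 5 then ρf / χ else 0)
      else 0

/-- The `(2N+8) × (2N+8)` Biot-DA propagation matrix along `x`. -/
noncomputable def biotA (N : ℕ) (lamf μ m β ρ ρf ρw χ : ℝ) :
    Matrix (Fin (2 * N + 8)) (Fin (2 * N + 8)) ℝ :=
  Matrix.of fun i j => biotAEntry lamf μ m β ρ ρf ρw χ i.val j.val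

theorem charpoly_fromBlocks_zero_right {R m n : Type*} [CommRing R] [Fintype m] [Fintype n]
    [DecidableEq m] [DecidableEq n] (P : Matrix m m R) (Q : Matrix n m R) :
    (Matrix.fromBlocks P 0 Q 0).charpoly = X ^ Fintype.card n * P.charpoly := by
  rw [Matrix.charpoly_fromBlocks_zero₁₂, Matrix.charpoly_zero, mul_comm]

/-- Splits the eight velocity, stress and pressure indices into the compressional block
`(0, 2, 4, 7)`, the shear block `(1, 5)` and the pair `(3, 6)`. -/
def compressionalShearEquiv : Fin 4 ⊕ (Fin 2 ⊕ Fin 2) ≃ Fin 8 where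
  toFun := Sum.elim ![0, 2, 4, 7] (Sum.elim ![1, 5] ![3, 6])
  invFun := ![.inl 0, .inr (.inl 0), .inl 1, .inr (.inr 0), .inl 2, .inr (.inl 1),
    .inr (.inr 1), .inl 3]
  left_inv := by decide
  right_inv := by decide

/-- The characteristic polynomial of an antidiagonal block matrix with `2 × 2` blocks. -/
theorem charpoly_antidiagonal_blocks {R : Type*} [CommRing R] (a b c d p q r s : R) :
    (!![0, 0, a, b; 0, 0, c, d; p, q, 0, 0; r, s, 0, 0] : Matrix (Fin 4) (Fin 4) R).charpoly =
      X ^ 4 - C (a * p + b * r + c * q + d * s) * X ^ 2 +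
        C ((a * d - b * c) * (p * s - q * r)) := by
  have hcm : Matrix.charmatrix !![0, 0, a, b; 0, 0, c, d; p, q, 0, 0; r, s, 0, 0] =
      !![X, 0, -C a, -C b; 0, X, -C c, -C d; -C p, -C q, X, 0; -C r, -C s, 0, X] := by
    ext1 i j
    fin_cases i <;> fin_cases j <;> simp
  rw [Matrix.charpoly, hcm]
  simp [Matrix.det_succ_row_zero, Fin.sum_univ_succ, Fin.succAbove]
  ring

/-- The characteristic polynomial of the `8 × 8` block of `biotA` acting on the velocities, the
stresses and the pressure. -/
theorem biotAEntry_charpoly_eight (lamf μ m β ρ ρf ρw χ : ℝ) :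
    (Matrix.of fun i j : Fin 8 => biotAEntry lamf μ m β ρ ρf ρw χ i.val j.val).charpoly =
      X ^ 2 * (X ^ 2 - C (μ * ρw / χ)) *
        (X ^ 4 - C (((lamf + 2 * μ) * ρw + m * (ρ - 2 * ρf * β)) / χ) * X ^ 2 +
          C (m * (lamf - m * β ^ 2 + 2 * μ) * (ρ * ρw - ρf ^ 2) / χ ^ 2)) := by
  have hblocks : Matrix.reindex compressionalShearEquiv.symm compressionalShearEquiv.symm
      (Matrix.of fun i j : Fin 8 => biotAEntry lamf μ m β ρ ρf ρw χ i.val j.val) =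
      Matrix.fromBlocks
        !![0, 0, -ρw / χ, -ρf / χ; 0, 0, ρf / χ, ρ / χ;
          -(lamf + 2 * μ), -(m * β), 0, 0; m * β, m, 0, 0] 0
        (Matrix.of (Sum.elim 0 ![0, ![-lamf, -(m * β), 0, 0]]))
        (Matrix.fromBlocks !![0, -ρw / χ; -μ, 0] 0 !![0, ρf / χ; 0, 0] 0) := by
    ext i j
    rcases i with i | i | i <;> rcases j with j | j | j <;> fin_cases i <;> fin_cases j <;>
      simp [compressionalShearEquiv, biotAEntry]
  rw [← Matrix.charpoly_reindex compressionalShearEquiv.symm, hblocks,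
    Matrix.charpoly_fromBlocks_zero₁₂, charpoly_fromBlocks_zero_right,
    charpoly_antidiagonal_blocks, Matrix.charpoly_fin_two]
  have hshear : -(-ρw / χ * -μ) = -(μ * ρw / χ) := by ring
  have htrace : -ρw / χ * -(lamf + 2 * μ) + -ρf / χ * (m * β) + ρf / χ * -(m * β) + ρ / χ * m =
      ((lamf + 2 * μ) * ρw + m * (ρ - 2 * ρf * β)) / χ := by ring
  have hdet : (-ρw / χ * (ρ / χ) - -ρf / χ * (ρf / χ)) *
      (-(lamf + 2 * μ) * m - -(m * β) * (m * β)) =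
      m * (lamf - m * β ^ 2 + 2 * μ) * (ρ * ρw - ρf ^ 2) / χ ^ 2 := by ring
  rw [htrace, hdet]
  simp only [Matrix.trace_fin_two_of, Matrix.det_fin_two_of, add_zero, mul_zero, zero_sub,
    hshear, C_neg, C_0, zero_mul, sub_zero, Fintype.card_fin]
  ring

theorem biotAEntry_eq_zero_of_le (lamf μ m β ρ ρf ρw χ : ℝ) {j : ℕ} (hj : 8 ≤ j) (i : ℕ) :
    biotAEntry lamf μ m β ρ ρf ρw χ i j = 0 := by
  unfold biotAEntry
  split <;> first | omega | split_ifs <;> first | omega | rfl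

/-- The diffusive variables only contribute the eigenvalue `0` to the spectrum of `biotA`. -/
theorem biotA_charpoly_eq_X_pow_mul (N : ℕ) (lamf μ m β ρ ρf ρw χ : ℝ) :
    (biotA N lamf μ m β ρ ρf ρw χ).charpoly = X ^ (2 * N) *
      (Matrix.of fun i j : Fin 8 => biotAEntry lamf μ m β ρ ρf ρw χ i.val j.val).charpoly := by
  obtain ⟨e, he_inl, he_inr⟩ : ∃ e : Fin 8 ⊕ Fin (2 * N) ≃ Fin (2 * N + 8),
      (∀ i, (e (Sum.inl i)).val = i.val) ∧ ∀ i, (e (Sum.inr i)).val = 8 + i.val :=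
    ⟨finSumFinEquiv.trans (finCongr (Nat.add_comm 8 (2 * N))), fun i => by simp,
      fun i => by simp [Nat.add_comm]⟩
  have hblocks : Matrix.reindex e.symm e.symm (biotA N lamf μ m β ρ ρf ρw χ) =
      Matrix.fromBlocks
        (Matrix.of fun i j : Fin 8 => biotAEntry lamf μ m β ρ ρf ρw χ i.val j.val) 0
        (Matrix.of fun (i : Fin (2 * N)) (j : Fin 8) =>
          biotAEntry lamf μ m β ρ ρf ρw χ (8 + i.val) j.val) 0 := by
    ext i (j | j)
    · rcases i with i | i <;> simp [he_inl, he_inr, biotA]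
    · have hj : biotA N lamf μ m β ρ ρf ρw χ (e i) (e (Sum.inr j)) = 0 :=
        biotAEntry_eq_zero_of_le lamf μ m β ρ ρf ρw χ (by simp [he_inr]) _
      rcases i with i | i <;> simpa using hj
  rw [← Matrix.charpoly_reindex e.symm, hblocks, charpoly_fromBlocks_zero_right, Fintype.card_fin]

/-- Hyperbolicity of the Biot-DA system: under the sign conditions on
`χ`, `μ`, `ρw`, `B = (λf+2μ)ρw + m(ρ−2ρfβ)`, `C = m(λ₀+2μ)` and the discriminant,
all eigenvalues of the propagation matrix `A` are real: the characteristic polynomial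
splits over `ℝ` as `X^(2N+2) (X−s)(X+s)(X−c_pf)(X+c_pf)(X−c_ps)(X+c_ps)` with
`s = √(μρw/χ)` and `c_pf² ≥ c_ps² > 0` the two roots of `χ X² − B X + C = 0`. -/
theorem biotA_eigenvalues_real (N : ℕ) (hN : 1 ≤ N)
    (lamf μ m β ρ ρf ρw χ lam0 Bco Cco : ℝ)
    (hχ : χ = ρ * ρw - ρf ^ 2)
    (hlam0 : lam0 = lamf - m * β ^ 2)
    (hBco : Bco = (lamf + 2 * μ) * ρw + m * (ρ - 2 * ρf * β))
    (hCco : Cco = m * (lam0 + 2 * μ))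
    (hχ0 : 0 < χ) (hμ : 0 < μ) (hρw : 0 < ρw)
    (hB : 0 < Bco) (hC : 0 < Cco)
    (hdisc : 0 ≤ Bco ^ 2 - 4 * χ * Cco) :
    ∃ cpf cps : ℝ,
      0 < cps ∧ cps ≤ cpf ∧
      cps ^ 2 > 0 ∧ cps ^ 2 ≤ cpf ^ 2 ∧
      χ * (cpf ^ 2) ^ 2 - Bco * cpf ^ 2 + Cco = 0 ∧
      χ * (cps ^ 2) ^ 2 - Bco * cps ^ 2 + Cco = 0 ∧
      (biotA N lamf μ m β ρ ρf ρw χ).charpoly =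
        X ^ (2 * N + 2) *
          ((X - C (Real.sqrt (μ * ρw / χ))) * (X + C (Real.sqrt (μ * ρw / χ)))) *
          ((X - C cpf) * (X + C cpf)) * ((X - C cps) * (X + C cps)) := by
  subst hlam0
  have hχne : χ ≠ 0 := hχ0.ne'
  set D := Real.sqrt (Bco ^ 2 - 4 * χ * Cco)
  have hD0 : 0 ≤ D := Real.sqrt_nonneg _
  have hDsq : D ^ 2 = Bco ^ 2 - 4 * χ * Cco := Real.sq_sqrt hdisc
  have hDB : D < Bco := by
    nlinarith [mul_pos hχ0 hC]
  have hsum : Bco / χ = (Bco + D) / (2 * χ) + (Bco - D) / (2 * χ) := by field_simp; ring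
  have hprod : Cco * χ / χ ^ 2 = (Bco + D) / (2 * χ) * ((Bco - D) / (2 * χ)) := by
    field_simp
    linear_combination hDsq
  have hslow : 0 < (Bco - D) / (2 * χ) := div_pos (by linarith) (by linarith)
  have hle : (Bco - D) / (2 * χ) ≤ (Bco + D) / (2 * χ) := by gcongr; linarith
  have hpf := Real.sq_sqrt (hslow.le.trans hle)
  have hps := Real.sq_sqrt hslow.le
  have hs := Real.sq_sqrt (show 0 ≤ μ * ρw / χ by positivity)
  refine ⟨√((Bco + D) / (2 * χ)), √((Bco - D) / (2 * χ)), Real.sqrt_pos.2 hslow,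
    Real.sqrt_le_sqrt hle, by rwa [hps], by rwa [hps, hpf], ?_, ?_, ?_⟩
  · rw [hpf]
    field_simp
    linear_combination hDsq
  · rw [hps]
    field_simp
    linear_combination hDsq
  · have hP := biotAEntry_charpoly_eight lamf μ m β ρ ρf ρw χ
    rw [← hBco, ← hCco, ← hχ] at hP
    have factor (c : ℝ) : (X - C c) * (X + C c) = X ^ 2 - C (c ^ 2) := by
      rw [C_pow]; ring
    rw [biotA_charpoly_eq_X_pow_mul, hP, factor, factor, factor, hs, hpf, hps, hsum, hprod,
      C_add, C_mul]
    ring
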